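/- Let w: [0,1] → ℝ be absolutely continuous with w(0) ≥ 0 and w' > 0 a.e., let d ≥ 2, and set y(x) = w(|x|) x/|x| on the punctured unit ball. If ∫_0^1 (|w'(R)| + |w(R)|/R) R^{d−1} dR < ∞, then y ∈ W^{1,1}(B₁; ℝ^d) and the distributional gradient of y has no singular part at the origin: ∇y = (w/R) I + (w' − w/R) x̂⊗x̂ as an L¹ function, even when w(0) > 0. -/

import Mathlib

open MeasureTheory

lemma cav_radInt (d : ℕ) (hd : 2 ≤ d) (h : ℝ → ℝ) (hh : IntegrableOn h (Set.Icc 0 1)) :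
    IntegrableOn (fun x : EuclideanSpace ℝ (Fin d) => h ‖x‖) (Metric.ball 0 1) := by
  have : Nonempty (Fin d) := ⟨⟨0, by omega⟩⟩
  rw [integrableOn_fun_norm_addHaar]
  have hh' : IntegrableOn h (Set.Ioo 0 1) := hh.mono_set Set.Ioo_subset_Icc_self
  refine Integrable.bdd_mul (c := 1) hh' (by fun_prop) ?_
  filter_upwards [ae_restrict_mem measurableSet_Ioo] with y hy
  rw [Real.norm_of_nonneg (pow_nonneg hy.1.le _)]
  exact pow_le_one₀ hy.1.le hy.2.le

lemma cav_radInt_div (d : ℕ) (hd : 2 ≤ d) (w : ℝ → ℝ) (hw : ContinuousOn w (Set.Icc 0 1)) :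
    IntegrableOn (fun x : EuclideanSpace ℝ (Fin d) => w ‖x‖ / ‖x‖) (Metric.ball 0 1) := by
  have : Nonempty (Fin d) := ⟨⟨0, by omega⟩⟩
  rw [integrableOn_fun_norm_addHaar volume (f := fun r => w r / r)]
  have h1 : IntegrableOn (fun y => y ^ (d - 2) * w y) (Set.Ioo 0 1) := by
    refine IntegrableOn.mono_set (t := Set.Icc 0 1) ?_ Set.Ioo_subset_Icc_self
    apply ContinuousOn.integrableOn_Icc
    fun_prop
  refine h1.congr_fun ?_ measurableSet_Ioo
  intro y hy
  have hy0 : y ≠ 0 := hy.1.ne'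
  simp only [finrank_euclideanSpace_fin, smul_eq_mul]
  obtain ⟨k, rfl⟩ := Nat.exists_eq_add_of_le hd
  have e1 : 2 + k - 2 = k := by omega
  have e2 : 2 + k - 1 = k + 1 := by omega
  rw [e1, e2]
  field_simp
  ring

lemma cav_radBound (d : ℕ) (hd : 2 ≤ d) (h : ℝ → ℝ) (hh : IntegrableOn h (Set.Icc 0 1)) :
    ∫ x in Metric.ball (0 : EuclideanSpace ℝ (Fin d)) 1, |h ‖x‖| ≤
      (d * volume.real (Metric.ball (0 : EuclideanSpace ℝ (Fin d)) 1)) *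
        ∫ r in Set.Icc (0:ℝ) 1, |h r| := by
  have : Nonempty (Fin d) := ⟨⟨0, by omega⟩⟩
  have e : ∫ x in Metric.ball (0 : EuclideanSpace ℝ (Fin d)) 1, |h ‖x‖| =
      ∫ x : EuclideanSpace ℝ (Fin d), (Set.Iio 1).indicator (fun r => |h r|) ‖x‖ := by
    rw [← integral_indicator measurableSet_ball]
    congr 1
    ext x
    simp [Set.indicator]
  rw [e, integral_fun_norm_addHaar volume]
  simp only [finrank_euclideanSpace_fin, nsmul_eq_mul, smul_eq_mul, mul_assoc]
  gcongr
  have e2 : ∫ y in Set.Ioi (0:ℝ), y ^ (d - 1) * (Set.Iio 1).indicator (fun r => |h r|) y =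
      ∫ y in Set.Ioo (0:ℝ) 1, y ^ (d - 1) * |h y| := by
    rw [← integral_indicator measurableSet_Ioi, ← integral_indicator measurableSet_Ioo]
    congr 1
    ext y
    by_cases h0 : 0 < y <;> by_cases h1 : y < 1 <;> simp [Set.indicator, h0, h1]
  rw [e2, integral_Icc_eq_integral_Ioo]
  have hh' : IntegrableOn h (Set.Ioo 0 1) := hh.mono_set Set.Ioo_subset_Icc_self
  have hi : IntegrableOn (fun y => |h y|) (Set.Ioo 0 1) := hh'.abs
  refine setIntegral_mono_on ?_ hi measurableSet_Ioo ?_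
  · refine Integrable.bdd_mul (c := 1) hi (by fun_prop) ?_
    filter_upwards [ae_restrict_mem measurableSet_Ioo] with y hy
    rw [Real.norm_of_nonneg (pow_nonneg hy.1.le _)]
    exact pow_le_one₀ hy.1.le hy.2.le
  · intro y hy
    exact mul_le_of_le_one_left (abs_nonneg _) (pow_le_one₀ hy.1.le hy.2.le)

/-- The combined integrand, with the radius replaced by a parameter `ρ`. -/
noncomputable def cavF {d : ℕ} (w g : ℝ → ℝ) (i j : Fin d)
    (D φ : EuclideanSpace ℝ (Fin d) → ℝ) (ρ : ℝ) (x : EuclideanSpace ℝ (Fin d)) : ℝ :=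
  (w ρ / ρ * x i) * D x +
    (w ρ / ρ * (if i = j then (1:ℝ) else 0) + (g ρ - w ρ / ρ) * (x i / ρ) * (x j / ρ)) * φ x

lemma cavG_bound {d : ℕ} (w g : ℝ → ℝ) (i j : Fin d) (ρ : ℝ) (x : EuclideanSpace ℝ (Fin d))
    (hx : x ≠ 0) (hρ : ‖x‖ ≤ ρ) :
    |w ρ / ρ * (if i = j then (1:ℝ) else 0) + (g ρ - w ρ / ρ) * (x i / ρ) * (x j / ρ)| ≤
      2 * (|w ρ| / ‖x‖) + |g ρ| := by
  have hx0 : 0 < ‖x‖ := norm_pos_iff.2 hx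
  have hρ0 : 0 < ρ := hx0.trans_le hρ
  have hu : ∀ k, |x k / ρ| ≤ 1 := fun k => by
    rw [abs_div, abs_of_pos hρ0, div_le_one hρ0]
    exact (PiLp.norm_apply_le x k).trans hρ
  have hw : |w ρ / ρ| ≤ |w ρ| / ‖x‖ := by
    rw [abs_div, abs_of_pos hρ0]
    gcongr
  have h1 : |w ρ / ρ * (if i = j then (1:ℝ) else 0)| ≤ |w ρ| / ‖x‖ := by
    rw [abs_mul]
    refine (mul_le_of_le_one_right (abs_nonneg _) ?_).trans hw
    split_ifs <;> simp
  have h2 : |(g ρ - w ρ / ρ) * (x i / ρ) * (x j / ρ)| ≤ |g ρ| + |w ρ| / ‖x‖ := by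
    rw [abs_mul, abs_mul]
    calc |g ρ - w ρ / ρ| * |x i / ρ| * |x j / ρ| ≤ |g ρ - w ρ / ρ| * 1 * 1 := by
          gcongr
          · exact hu i
          · exact hu j
      _ ≤ |g ρ| + |w ρ / ρ| := by rw [mul_one, mul_one]; exact abs_sub _ _
      _ ≤ _ := by gcongr
  calc _ ≤ _ := abs_add_le _ _
    _ ≤ _ := add_le_add h1 h2
    _ = _ := by ring

lemma cavF_bound {d : ℕ} (w g : ℝ → ℝ) (i j : Fin d)
    (D φ : EuclideanSpace ℝ (Fin d) → ℝ) (M : ℝ) (hD : ∀ x, |D x| ≤ M) (hφ : ∀ x, |φ x| ≤ M)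
    (ρ : ℝ) (x : EuclideanSpace ℝ (Fin d)) (hx : x ≠ 0) (hρ : ‖x‖ ≤ ρ) :
    |cavF w g i j D φ ρ x| ≤ (|w ρ| + (2 * (|w ρ| / ‖x‖) + |g ρ|)) * M := by
  have hx0 : 0 < ‖x‖ := norm_pos_iff.2 hx
  have hρ0 : 0 < ρ := hx0.trans_le hρ
  have h1 : |w ρ / ρ * x i| ≤ |w ρ| := by
    have : w ρ / ρ * x i = w ρ * (x i / ρ) := by ring
    rw [this, abs_mul]
    refine mul_le_of_le_one_right (abs_nonneg _) ?_
    rw [abs_div, abs_of_pos hρ0, div_le_one hρ0]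
    exact (PiLp.norm_apply_le x i).trans hρ
  unfold cavF
  calc _ ≤ _ := abs_add_le _ _
    _ ≤ |w ρ| * M + (2 * (|w ρ| / ‖x‖) + |g ρ|) * M := by
      rw [abs_mul (w ρ / ρ * x i), abs_mul _ (φ x)]
      exact add_le_add (mul_le_mul h1 (hD x) (abs_nonneg _) (abs_nonneg _))
        (mul_le_mul (cavG_bound w g i j ρ x hx hρ) (hφ x) (abs_nonneg _) (by positivity))
    _ = _ := by ring

lemma cav_ae_ne (d : ℕ) (hd : 2 ≤ d) :
    ∀ᵐ x ∂(volume.restrict (Metric.ball (0 : EuclideanSpace ℝ (Fin d)) 1)), x ≠ 0 := by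
  have : Nonempty (Fin d) := ⟨⟨0, by omega⟩⟩
  exact ae_restrict_of_ae (Measure.ae_ne volume 0)

lemma cav_y_int (d : ℕ) (hd : 2 ≤ d) (w : ℝ → ℝ) (hcont : ContinuousOn w (Set.Icc 0 1)) :
    IntegrableOn (fun x : EuclideanSpace ℝ (Fin d) => (w ‖x‖ / ‖x‖) • x)
        (Metric.ball 0 1) := by
  have h1 := cav_radInt_div d hd w hcont
  have h2 := cav_radInt d hd w hcont.integrableOn_Icc
  refine Integrable.mono h2 (h1.aestronglyMeasurable.smul (by fun_prop)) ?_
  filter_upwards [cav_ae_ne d hd] with x hx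
  have hx0 : 0 < ‖x‖ := norm_pos_iff.2 hx
  rw [norm_smul, norm_div, norm_norm]
  apply le_of_eq
  field_simp

lemma cav_G_int (d : ℕ) (hd : 2 ≤ d) (w g : ℝ → ℝ)
    (hcont : ContinuousOn w (Set.Icc 0 1))
    (hg : IntegrableOn g (Set.Icc 0 1)) (i j : Fin d) : IntegrableOn
        (fun x : EuclideanSpace ℝ (Fin d) =>
          (w ‖x‖ / ‖x‖) * (if i = j then (1:ℝ) else 0)
            + (g ‖x‖ - w ‖x‖ / ‖x‖) * (x i / ‖x‖) * (x j / ‖x‖))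
        (Metric.ball 0 1) := by
  have h1 := cav_radInt_div d hd w hcont
  have h1' := cav_radInt_div d hd _ hcont.abs
  have h2 := cav_radInt d hd g hg
  have m : ∀ k : Fin d, Measurable (fun x : EuclideanSpace ℝ (Fin d) => x k / ‖x‖) := fun k => by
    fun_prop
  refine Integrable.mono' ((h1'.const_mul 2).add h2.abs) ?_ ?_
  · exact (h1.aestronglyMeasurable.mul_const _).add
      (((h2.aestronglyMeasurable.sub h1.aestronglyMeasurable).mul (m i).aestronglyMeasurable).mul
        (m j).aestronglyMeasurable)
  · filter_upwards [cav_ae_ne d hd] with x hx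
    exact cavG_bound w g i j _ x hx le_rfl

lemma cavF_int (d : ℕ) (hd : 2 ≤ d) (w g : ℝ → ℝ)
    (hcont : ContinuousOn w (Set.Icc 0 1))
    (hg : IntegrableOn g (Set.Icc 0 1)) (i j : Fin d)
    (D φ : EuclideanSpace ℝ (Fin d) → ℝ) (M : ℝ) (hD : ∀ x, |D x| ≤ M) (hφ : ∀ x, |φ x| ≤ M)
    (hDc : Continuous D) (hφc : Continuous φ) :
    IntegrableOn (fun x : EuclideanSpace ℝ (Fin d) => ((w ‖x‖ / ‖x‖) • x) i * D x)
      (Metric.ball 0 1) ∧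
    IntegrableOn (fun x : EuclideanSpace ℝ (Fin d) =>
          ((w ‖x‖ / ‖x‖) * (if i = j then (1:ℝ) else 0)
            + (g ‖x‖ - w ‖x‖ / ‖x‖) * (x i / ‖x‖) * (x j / ‖x‖)) * φ x)
        (Metric.ball 0 1) ∧ 
    IntegrableOn (fun x => cavF w g i j D φ ‖x‖ x) (Metric.ball 0 1) := by
  have h1 := cav_y_int d hd w hcont
  have h1' : IntegrableOn (fun x : EuclideanSpace ℝ (Fin d) => ((w ‖x‖ / ‖x‖) • x) i)
      (Metric.ball 0 1) := 
    (EuclideanSpace.proj (𝕜 := ℝ) i).integrable_comp h1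
  have h2 := cav_G_int d hd w g hcont hg i j
  have a := Integrable.mul_bdd (c := M) h1' hDc.aestronglyMeasurable (.of_forall hD)
  have b := Integrable.mul_bdd (c := M) h2 hφc.aestronglyMeasurable (.of_forall hφ)
  exact ⟨a, b, a.add b⟩

lemma cav_reg_deriv {d : ℕ} (w g : ℝ → ℝ) (hw : ∀ r, HasDerivAt w (g r) r) (i j : Fin d)
    (ε : ℝ) (hε : 0 < ε) (x : EuclideanSpace ℝ (Fin d)) :
    DifferentiableAt ℝ (fun x : EuclideanSpace ℝ (Fin d) =>
      w (√(‖x‖ ^ 2 + ε)) / √(‖x‖ ^ 2 + ε) * x i) x ∧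
    fderiv ℝ (fun x : EuclideanSpace ℝ (Fin d) =>
      w (√(‖x‖ ^ 2 + ε)) / √(‖x‖ ^ 2 + ε) * x i) x (EuclideanSpace.single j 1) =
    w (√(‖x‖ ^ 2 + ε)) / √(‖x‖ ^ 2 + ε) * (if i = j then (1:ℝ) else 0) +
      (g (√(‖x‖ ^ 2 + ε)) - w (√(‖x‖ ^ 2 + ε)) / √(‖x‖ ^ 2 + ε)) *
        (x i / √(‖x‖ ^ 2 + ε)) * (x j / √(‖x‖ ^ 2 + ε)) := by
  have hpos : 0 < ‖x‖ ^ 2 + ε := by positivity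
  have hρ : 0 < √(‖x‖ ^ 2 + ε) := Real.sqrt_pos.2 hpos
  have h1 : HasFDerivAt (fun x : EuclideanSpace ℝ (Fin d) => ‖x‖ ^ 2 + ε) (2 • innerSL ℝ x) x :=
    (hasStrictFDerivAt_norm_sq x).hasFDerivAt.add_const ε
  have h2 := h1.sqrt hpos.ne'
  have h3 := ((hw (√(‖x‖ ^ 2 + ε))).div (hasDerivAt_id _) hρ.ne').comp_hasFDerivAt x h2
  have h4 : HasFDerivAt (fun x : EuclideanSpace ℝ (Fin d) => x i)
      (EuclideanSpace.proj (𝕜 := ℝ) i) x := (EuclideanSpace.proj (𝕜 := ℝ) i).hasFDerivAt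
  have h5 := h3.mul h4
  refine ⟨h5.differentiableAt, ?_⟩
  have h6 := h5.fderiv
  have h7 := congrArg (fun L => L (EuclideanSpace.single j 1)) h6
  refine h7.trans ?_
  simp [PiLp.single_apply, EuclideanSpace.inner_single_right]
  generalize √(‖x‖ ^ 2 + ε) = ρ at *
  field_simp

lemma cav_reg {d : ℕ} (w g : ℝ → ℝ) (hw : ∀ r, HasDerivAt w (g r) r) (hgc : Continuous g)
    (i j : Fin d) (ψ : EuclideanSpace ℝ (Fin d) → ℝ) (hψ : ContDiff ℝ (⊤ : ℕ∞) ψ)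
    (hc : HasCompactSupport ψ) (hs : tsupport ψ ⊆ Metric.ball 0 1) (ε : ℝ) (hε : 0 < ε) :
    ∫ x in Metric.ball (0 : EuclideanSpace ℝ (Fin d)) 1,
      cavF w g i j (fun x => fderiv ℝ ψ x (EuclideanSpace.single j 1)) ψ (√(‖x‖ ^ 2 + ε)) x = 0 := by
  have hwc : Continuous w := continuous_iff_continuousAt.2 fun r => (hw r).continuousAt
  have hne : ∀ x : EuclideanSpace ℝ (Fin d), √(‖x‖ ^ 2 + ε) ≠ 0 := fun x =>
    (Real.sqrt_pos.2 (by positivity)).ne'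
  have hDc : Continuous (fun x => fderiv ℝ ψ x (EuclideanSpace.single j 1)) :=
    (hψ.continuous_fderiv (by simp)).clm_apply continuous_const
  have hDs : HasCompactSupport (fun x => fderiv ℝ ψ x (EuclideanSpace.single j 1)) :=
    hc.fderiv_apply ℝ _
  set f := (fun x : EuclideanSpace ℝ (Fin d) =>
      w (√(‖x‖ ^ 2 + ε)) / √(‖x‖ ^ 2 + ε) * x i) with hf
  have hfc : Continuous f := by
    have : Continuous (fun x : EuclideanSpace ℝ (Fin d) => √(‖x‖ ^ 2 + ε)) := by fun_prop
    exact ((hwc.comp this).div this hne).mul (by fun_prop)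
  have hdf := fun x => cav_reg_deriv w g hw i j ε hε x
  have hf'c : Continuous (fun x => fderiv ℝ f x (EuclideanSpace.single j 1)) := by
    have e := funext fun x => (hdf x).2
    rw [e]
    have : Continuous (fun x : EuclideanSpace ℝ (Fin d) => √(‖x‖ ^ 2 + ε)) := by fun_prop
    have a := (hwc.comp this).div this hne
    have b : ∀ k : Fin d, Continuous fun x : EuclideanSpace ℝ (Fin d) => x k / √(‖x‖ ^ 2 + ε) :=
      fun k => Continuous.div (by fun_prop) this hne
    exact (a.mul continuous_const).add ((((hgc.comp this).sub a).mul (b i)).mul (b j))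
  have I1 : Integrable (fun x => fderiv ℝ f x (EuclideanSpace.single j 1) * ψ x) :=
    (hf'c.mul hψ.continuous).integrable_of_hasCompactSupport hc.mul_left
  have I2 : Integrable (fun x => f x * fderiv ℝ ψ x (EuclideanSpace.single j 1)) :=
    (hfc.mul hDc).integrable_of_hasCompactSupport hDs.mul_left
  have I3 : Integrable (fun x => f x * ψ x) :=
    (hfc.mul hψ.continuous).integrable_of_hasCompactSupport hc.mul_left
  have key := integral_mul_fderiv_eq_neg_fderiv_mul_of_integrable I1 I2 I3
    (fun x _ => (hdf x).1) (fun x _ => hψ.differentiable (by simp) x)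
  have hF : ∀ x, cavF w g i j (fun x => fderiv ℝ ψ x (EuclideanSpace.single j 1)) ψ
      (√(‖x‖ ^ 2 + ε)) x = f x * fderiv ℝ ψ x (EuclideanSpace.single j 1) +
        fderiv ℝ f x (EuclideanSpace.single j 1) * ψ x := fun x => by
    rw [(hdf x).2]; rfl
  rw [setIntegral_eq_integral_of_forall_compl_eq_zero]
  · simp_rw [hF]
    rw [integral_add I2 I1, key]; ring
  · intro x hx
    have hx' : x ∉ tsupport ψ := fun h => hx (hs h)
    rw [hF, image_eq_zero_of_notMem_tsupport hx', fderiv_of_notMem_tsupport ℝ hx']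
    simp

open Filter Topology in
lemma cav_C1 {d : ℕ} (hd : 2 ≤ d) (w g : ℝ → ℝ) (hw : ∀ r, HasDerivAt w (g r) r)
    (hgc : Continuous g)
    (i j : Fin d) (ψ : EuclideanSpace ℝ (Fin d) → ℝ) (hψ : ContDiff ℝ (⊤ : ℕ∞) ψ)
    (hc : HasCompactSupport ψ) (hs : tsupport ψ ⊆ Metric.ball 0 1) (M : ℝ)
    (hD : ∀ x, |fderiv ℝ ψ x (EuclideanSpace.single j 1)| ≤ M) (hφ : ∀ x, |ψ x| ≤ M) :
    ∫ x in Metric.ball (0 : EuclideanSpace ℝ (Fin d)) 1,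
      cavF w g i j (fun x => fderiv ℝ ψ x (EuclideanSpace.single j 1)) ψ ‖x‖ x = 0 := by
  have hwc : Continuous w := continuous_iff_continuousAt.2 fun r => (hw r).continuousAt
  have hDc : Continuous (fun x => fderiv ℝ ψ x (EuclideanSpace.single j 1)) :=
    (hψ.continuous_fderiv (by simp)).clm_apply continuous_const
  have hψc := hψ.continuous
  obtain ⟨A, hA⟩ := isCompact_Icc.exists_bound_of_continuousOn (s := Set.Icc (0:ℝ) 2)
    hwc.continuousOn
  obtain ⟨B, hB⟩ := isCompact_Icc.exists_bound_of_continuousOn (s := Set.Icc (0:ℝ) 2)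
    hgc.continuousOn
  have hM : 0 ≤ M := (abs_nonneg _).trans (hφ 0)
  have hlim : Tendsto (fun ε : ℝ => ∫ x in Metric.ball (0 : EuclideanSpace ℝ (Fin d)) 1,
      cavF w g i j (fun x => fderiv ℝ ψ x (EuclideanSpace.single j 1)) ψ (√(‖x‖ ^ 2 + ε)) x)
      (𝓝[>] 0) (𝓝 (∫ x in Metric.ball (0 : EuclideanSpace ℝ (Fin d)) 1,
      cavF w g i j (fun x => fderiv ℝ ψ x (EuclideanSpace.single j 1)) ψ ‖x‖ x)) := by
    refine tendsto_integral_filter_of_dominated_convergence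
      (fun x => (A + (2 * (A / ‖x‖) + B)) * M) ?_ ?_ ?_ ?_
    · refine .of_forall fun ε => Measurable.aestronglyMeasurable ?_
      have hwm := hwc.measurable
      have hgm := hgc.measurable
      have hψm := hψc.measurable
      have hDm := hDc.measurable
      unfold cavF
      fun_prop
    · filter_upwards [Ioo_mem_nhdsGT (show (0:ℝ) < 1 by norm_num)] with ε hε
      filter_upwards [cav_ae_ne d hd, ae_restrict_mem measurableSet_ball] with x hx hx1
      rw [mem_ball_zero_iff] at hx1
      have h1 : ‖x‖ ≤ √(‖x‖ ^ 2 + ε) := Real.le_sqrt_of_sq_le (by linarith [hε.1])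
      have h2 : √(‖x‖ ^ 2 + ε) ≤ 2 := by
        rw [Real.sqrt_le_left (by norm_num)]
        nlinarith [hε.2, norm_nonneg x]
      have hm : √(‖x‖ ^ 2 + ε) ∈ Set.Icc (0:ℝ) 2 := ⟨Real.sqrt_nonneg _, h2⟩
      refine (cavF_bound w g i j _ ψ M hD hφ _ x hx h1).trans ?_
      have a := hA _ hm
      have b := hB _ hm
      rw [Real.norm_eq_abs] at a b
      gcongr
    · have e1 := cav_radInt_div d hd (fun _ => A) continuousOn_const
      have e2 : ∀ c : ℝ, IntegrableOn (fun _ : EuclideanSpace ℝ (Fin d) => c)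
        (Metric.ball 0 1) := fun c => cav_radInt d hd (fun _ => c) continuousOn_const.integrableOn_Icc
      exact ((e2 A).add ((e1.const_mul 2).add (e2 B))).mul_const M
    · filter_upwards [cav_ae_ne d hd] with x hx
      have hx0 : ‖x‖ ≠ 0 := norm_ne_zero_iff.2 hx
      have hr : Tendsto (fun ε : ℝ => √(‖x‖ ^ 2 + ε)) (𝓝[>] 0) (𝓝 ‖x‖) := by
        have : ContinuousAt (fun ε : ℝ => √(‖x‖ ^ 2 + ε)) 0 := by fun_prop
        have h := this.tendsto
        simp only [add_zero, Real.sqrt_sq (norm_nonneg x)] at h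
        exact h.mono_left nhdsWithin_le_nhds
      have hcF : ContinuousAt (fun ρ => cavF w g i j
          (fun x => fderiv ℝ ψ x (EuclideanSpace.single j 1)) ψ ρ x) ‖x‖ := by
        unfold cavF
        have := hwc.continuousAt (x := ‖x‖)
        have := hgc.continuousAt (x := ‖x‖)
        fun_prop (disch := assumption)
      exact hcF.tendsto.comp hr
  refine tendsto_nhds_unique hlim (tendsto_const_nhds.congr' ?_)
  filter_upwards [self_mem_nhdsWithin] with ε hε
  exact (cav_reg w g hw hgc i j ψ hψ hc hs ε hε).symm

theorem radial_cavity_no_singular_part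
    (d : ℕ) (hd : 2 ≤ d) (w g : ℝ → ℝ)
    (hcont : ContinuousOn w (Set.Icc 0 1))
    (hg : IntegrableOn g (Set.Icc 0 1))
    (hac : ∀ R ∈ Set.Icc (0:ℝ) 1, w R = w 0 + ∫ s in (0:ℝ)..R, g s)
    (h0 : 0 ≤ w 0)
    (hpos : ∀ᵐ s ∂(volume.restrict (Set.Icc (0:ℝ) 1)), 0 < g s)
    (hen : IntegrableOn (fun R : ℝ => (|g R| + |w R| / R) * R ^ (d - 1)) (Set.Ioc (0:ℝ) 1)) :
    IntegrableOn (fun x : EuclideanSpace ℝ (Fin d) => (w ‖x‖ / ‖x‖) • x)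
        (Metric.ball 0 1)
    ∧ (∀ i j : Fin d, IntegrableOn
        (fun x : EuclideanSpace ℝ (Fin d) =>
          (w ‖x‖ / ‖x‖) * (if i = j then (1:ℝ) else 0)
            + (g ‖x‖ - w ‖x‖ / ‖x‖) * (x i / ‖x‖) * (x j / ‖x‖))
        (Metric.ball 0 1))
    ∧ ∀ ψ : EuclideanSpace ℝ (Fin d) → ℝ, ContDiff ℝ (⊤ : ℕ∞) ψ → HasCompactSupport ψ →
        tsupport ψ ⊆ Metric.ball 0 1 → ∀ i j : Fin d,
        ∫ x in Metric.ball (0 : EuclideanSpace ℝ (Fin d)) 1,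
            ((w ‖x‖ / ‖x‖) • x) i * fderiv ℝ ψ x (EuclideanSpace.single j 1)
          = - ∫ x in Metric.ball (0 : EuclideanSpace ℝ (Fin d)) 1,
            ((w ‖x‖ / ‖x‖) * (if i = j then (1:ℝ) else 0)
              + (g ‖x‖ - w ‖x‖ / ‖x‖) * (x i / ‖x‖) * (x j / ‖x‖)) * ψ x := by
  refine ⟨cav_y_int d hd w hcont, cav_G_int d hd w g hcont hg, ?_⟩
  intro ψ hψ hc hs i j
  have hDc : Continuous (fun x => fderiv ℝ ψ x (EuclideanSpace.single j 1)) :=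
    (hψ.continuous_fderiv (by simp)).clm_apply continuous_const
  have hDs : HasCompactSupport (fun x => fderiv ℝ ψ x (EuclideanSpace.single j 1)) :=
    hc.fderiv_apply ℝ _
  obtain ⟨M₁, hM₁⟩ := hc.exists_bound_of_continuous hψ.continuous
  obtain ⟨M₂, hM₂⟩ := hDs.exists_bound_of_continuous hDc
  obtain ⟨M, hφ, hD⟩ : ∃ M, (∀ x, |ψ x| ≤ M) ∧
      ∀ x, |fderiv ℝ ψ x (EuclideanSpace.single j 1)| ≤ M :=
    ⟨max M₁ M₂, fun x => (hM₁ x).trans (le_max_left _ _), fun x => (hM₂ x).trans (le_max_right _ _)⟩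
  have hM : 0 ≤ M := (abs_nonneg _).trans (hφ 0)
  obtain ⟨J1, J2, J3⟩ := cavF_int d hd w g hcont hg i j _ ψ M hD hφ hDc hψ.continuous
  rw [eq_neg_iff_add_eq_zero, ← integral_add J1 J2]
  change ∫ x in Metric.ball (0 : EuclideanSpace ℝ (Fin d)) 1,
      cavF w g i j (fun x => fderiv ℝ ψ x (EuclideanSpace.single j 1)) ψ ‖x‖ x = 0
  set V := volume.real (Metric.ball (0 : EuclideanSpace ℝ (Fin d)) 1) with hV
  set N := ∫ x in Metric.ball (0 : EuclideanSpace ℝ (Fin d)) 1, 1 / ‖x‖ with hN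
  have hN0 : 0 ≤ N := integral_nonneg fun x => by positivity
  have hV0 : 0 ≤ V := measureReal_nonneg
  -- the main estimate, by density of continuous functions
  have main : ∀ ε : ℝ, 0 < ε → |∫ x in Metric.ball (0 : EuclideanSpace ℝ (Fin d)) 1,
      cavF w g i j (fun x => fderiv ℝ ψ x (EuclideanSpace.single j 1)) ψ ‖x‖ x| ≤
      ((V + 2 * N + d * V) * M) * ε := by
    intro ε hε
    have hgi : Integrable ((Set.Icc (0:ℝ) 1).indicator g) := by
      rwa [integrable_indicator_iff measurableSet_Icc]
    obtain ⟨g', -, hgg, hg'c, hg'i⟩ := hgi.exists_hasCompactSupport_integral_sub_le hε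
    set w' : ℝ → ℝ := fun r => w 0 + ∫ s in (0:ℝ)..r, g' s with hw'
    have hdw : ∀ r, HasDerivAt w' (g' r) r := fun r =>
      (hg'c.integral_hasStrictDerivAt 0 r).hasDerivAt.const_add (w 0)
    have hw'c : Continuous w' := continuous_iff_continuousAt.2 fun r => (hdw r).continuousAt
    have z := cav_C1 hd w' g' hdw hg'c i j ψ hψ hc hs M hD hφ
    have hg'I : IntegrableOn g' (Set.Icc 0 1) := hg'i.integrableOn
    obtain ⟨-, -, J3'⟩ := cavF_int d hd w' g' hw'c.continuousOn hg'I i j _ ψ M hD hφ hDc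
      hψ.continuous
    have hdiffI : IntegrableOn (fun r => g r - g' r) (Set.Icc 0 1) := hg.sub hg'I
    have hL1 : ∫ r in Set.Icc (0:ℝ) 1, |g r - g' r| ≤ ε := by
      refine le_trans ?_ hgg
      have : ∫ r in Set.Icc (0:ℝ) 1, |g r - g' r| =
          ∫ r in Set.Icc (0:ℝ) 1, ‖(Set.Icc (0:ℝ) 1).indicator g r - g' r‖ := by
        refine setIntegral_congr_fun measurableSet_Icc fun r hr => ?_
        simp only [Set.indicator_of_mem hr, Real.norm_eq_abs]
      rw [this]
      exact setIntegral_le_integral (hgi.sub hg'i).norm (.of_forall fun r => norm_nonneg _)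
    have hwd : ∀ r ∈ Set.Icc (0:ℝ) 1, |w r - w' r| ≤ ε := by
      intro r hr
      have hsub : Set.Ioc 0 r ⊆ Set.Icc (0:ℝ) 1 := fun s hs => ⟨hs.1.le, hs.2.trans hr.2⟩
      have i1 : IntervalIntegrable g volume 0 r :=
        (intervalIntegrable_iff_integrableOn_Ioc_of_le hr.1).2 (hg.mono_set hsub)
      have : w r - w' r = ∫ s in (0:ℝ)..r, (g s - g' s) := by
        rw [intervalIntegral.integral_sub i1 (hg'c.intervalIntegrable _ _), hac r hr, hw']
        ring
      rw [this, intervalIntegral.integral_of_le hr.1]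
      refine (abs_integral_le_integral_abs).trans (le_trans ?_ hL1)
      exact setIntegral_mono_set hdiffI.abs (.of_forall fun s => abs_nonneg _)
        (LE.le.eventuallyLE hsub)
    have e : ∫ x in Metric.ball (0 : EuclideanSpace ℝ (Fin d)) 1,
        cavF w g i j (fun x => fderiv ℝ ψ x (EuclideanSpace.single j 1)) ψ ‖x‖ x =
        ∫ x in Metric.ball (0 : EuclideanSpace ℝ (Fin d)) 1,
        cavF (fun r => w r - w' r) (fun r => g r - g' r) i j
          (fun x => fderiv ℝ ψ x (EuclideanSpace.single j 1)) ψ ‖x‖ x := by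
      rw [← sub_zero (∫ x in Metric.ball (0 : EuclideanSpace ℝ (Fin d)) 1,
        cavF w g i j (fun x => fderiv ℝ ψ x (EuclideanSpace.single j 1)) ψ ‖x‖ x), ← z,
        ← integral_sub J3 J3']
      congr 1
      ext x
      unfold cavF
      ring
    rw [e]
    have k1 : IntegrableOn (fun x : EuclideanSpace ℝ (Fin d) => 1 / ‖x‖) (Metric.ball 0 1) :=
      cav_radInt_div d hd (fun _ => 1) continuousOn_const
    have k2 : IntegrableOn (fun x : EuclideanSpace ℝ (Fin d) => |g ‖x‖ - g' ‖x‖|)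
      (Metric.ball 0 1) := (cav_radInt d hd _ hdiffI).abs
    have k3 : IntegrableOn (fun _ : EuclideanSpace ℝ (Fin d) => ε) (Metric.ball 0 1) :=
      cav_radInt d hd (fun _ => ε) continuousOn_const.integrableOn_Icc
    have k4 := k3.add (k1.const_mul (2 * ε))
    have k5 := (k4.add k2).mul_const M
    have bd := norm_integral_le_of_norm_le k5 (f := fun x =>
        cavF (fun r => w r - w' r) (fun r => g r - g' r) i j
          (fun x => fderiv ℝ ψ x (EuclideanSpace.single j 1)) ψ ‖x‖ x) (by
      filter_upwards [cav_ae_ne d hd, ae_restrict_mem measurableSet_ball] with x hx hx1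
      rw [mem_ball_zero_iff] at hx1
      refine (cavF_bound _ _ i j _ ψ M hD hφ _ x hx le_rfl).trans ?_
      have a := hwd ‖x‖ ⟨norm_nonneg x, hx1.le⟩
      have hx0 : 0 < ‖x‖ := norm_pos_iff.2 hx
      refine mul_le_mul_of_nonneg_right ?_ hM
      have a2 : |w ‖x‖ - w' ‖x‖| / ‖x‖ ≤ ε / ‖x‖ := by gcongr
      have a3 : 2 * ε * (1 / ‖x‖) = 2 * (ε / ‖x‖) := by ring
      simp only [Pi.add_apply]
      rw [a3]
      linarith)
    refine bd.trans ?_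
    have r1 := cav_radBound d hd _ hdiffI
    have : ∫ x in Metric.ball (0 : EuclideanSpace ℝ (Fin d)) 1,
        (((fun _ : EuclideanSpace ℝ (Fin d) => ε) + fun x => 2 * ε * (1 / ‖x‖)) +
          fun x => |g ‖x‖ - g' ‖x‖| : EuclideanSpace ℝ (Fin d) → ℝ) x * M =
        (V * ε + 2 * ε * N +
          ∫ x in Metric.ball (0 : EuclideanSpace ℝ (Fin d)) 1, |g ‖x‖ - g' ‖x‖|) * M := by
      rw [integral_mul_const, integral_add' k4 k2, integral_add' k3 (k1.const_mul (2 * ε)),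
        integral_const_mul]
      simp [hV, hN]
    rw [this]
    have r2 : (d * V) * ∫ r in Set.Icc (0:ℝ) 1, |g r - g' r| ≤ (d * V) * ε := by gcongr
    calc _ ≤ (V * ε + 2 * ε * N + d * V * ε) * M := by
          gcongr
          exact r1.trans r2
      _ = _ := by ring
  by_contra hne
  have hp := abs_pos.2 hne
  set a := |∫ x in Metric.ball (0 : EuclideanSpace ℝ (Fin d)) 1,
      cavF w g i j (fun x => fderiv ℝ ψ x (EuclideanSpace.single j 1)) ψ ‖x‖ x| with ha
  set K := (V + 2 * N + d * V) * M with hK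
  have hK0 : 0 ≤ K := by positivity
  have := main (a / (2 * (K + 1))) (by positivity)
  have h2 : K * (a / (2 * (K + 1))) < a := by
    rw [mul_div_assoc', div_lt_iff₀ (by positivity)]
    nlinarith
  linarith
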